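/- arXiv:2409.16390 — 2 statements merged into one kernel-verified Lean document; each statement's English description precedes it below -/
import Mathlib

section
/- Let C~ and C~′ be r-perfect S-complexes over a commutative ring R and let λ~: C~ → C~′ be an even-degree morphism which has height n (respectively, strong height n) for some integer n ≥ 1. Then: (a) the map ι~_n: C~ → Σ^n C~ is a strong height n morphism; and (b) there exists a height 0 (respectively, strong height 0) morphism λ~′: Σ^n C~ → C~′ whose ρ-component equals τ_n(λ~) such that λ~′ ∘ ι~_n = λ~. -/
set_option maxHeartbeats 1000000

open Function

universe u

/-- A `ℤ`-graded `R`-module, presented as an `R`-module together with a family of submodules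
(the homogeneous pieces). -/
structure GradedMod (R : Type u) [CommRing R] : Type (u + 1) where
  carrier : Type u
  [isAddCommGroup : AddCommGroup carrier]
  [isModule : Module R carrier]
  grading : ℤ → Submodule R carrier

attribute [instance] GradedMod.isAddCommGroup GradedMod.isModule

namespace GradedMod

variable {R : Type u} [CommRing R]

/-- `f` is homogeneous of degree `k` with respect to the gradings. -/
def IsDeg (M N : GradedMod R) (k : ℤ) (f : M.carrier →ₗ[R] N.carrier) : Prop :=
  ∀ i : ℤ, (M.grading i).map f ≤ N.grading (i + k)

/-- The grading is an internal direct sum decomposition with finitely generated free pieces,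
only finitely many of which are nonzero; i.e., the graded module is finitely generated and
free as a graded `R`-module. -/
def IsFGFree (M : GradedMod R) : Prop :=
  DirectSum.IsInternal M.grading ∧ (∀ i : ℤ, Module.Free R ↥(M.grading i)) ∧
    (∀ i : ℤ, Module.Finite R ↥(M.grading i)) ∧ {i : ℤ | M.grading i ≠ ⊥}.Finite

/-- `e` is the sign operator `ε`, acting on the degree `i` homogeneous part by `(-1)^i`. -/
def IsSign (M : GradedMod R) (e : M.carrier →ₗ[R] M.carrier) : Prop :=
  ∀ i : ℤ, ∀ x ∈ M.grading i, e x = if Even i then x else -x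

/-- The shift `M[n]`, with `M[n]_j = M_{n+j}`. -/
def shift (M : GradedMod R) (n : ℤ) : GradedMod R where
  carrier := M.carrier
  grading j := M.grading (n + j)

/-- Direct sum (product) of graded modules. -/
def prodGM (M N : GradedMod R) : GradedMod R where
  carrier := M.carrier × N.carrier
  grading j := (M.grading j).prod (N.grading j)

/-- Tensor product of graded modules, `(M ⊗ N)_k = ⊕_{i+j=k} M_i ⊗ N_j`. -/
noncomputable def tensorGM (M N : GradedMod R) : GradedMod R where
  carrier := TensorProduct R M.carrier N.carrier
  grading k := ⨆ i : ℤ, Submodule.map₂ (TensorProduct.mk R M.carrier N.carrier)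
      (M.grading i) (N.grading (k - i))

/-- Dual of a graded module: a functional has degree `-i` if it kills all `M_j`, `j ≠ i`. -/
def dualGM (M : GradedMod R) : GradedMod R where
  carrier := Module.Dual R M.carrier
  grading j := ⨅ (i : ℤ) (_ : i ≠ -j), (M.grading i).dualAnnihilator

end GradedMod

variable {R : Type u} [CommRing R]

/-- Iterated composition of a linear endomorphism. -/
def lpow {M : Type u} [AddCommGroup M] [Module R M] (f : M →ₗ[R] M) : ℕ → (M →ₗ[R] M)
  | 0 => LinearMap.id
  | n + 1 => f ∘ₗ lpow f n

section ProdHelpers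

variable {A B C D E : Type u} [AddCommGroup A] [Module R A] [AddCommGroup B] [Module R B]
  [AddCommGroup C] [Module R C] [AddCommGroup D] [Module R D] [AddCommGroup E] [Module R E]

def pj₁ : (A × B × C) →ₗ[R] A := LinearMap.fst R A (B × C)
def pj₂ : (A × B × C) →ₗ[R] B := (LinearMap.fst R B C) ∘ₗ (LinearMap.snd R A (B × C))
def pj₃ : (A × B × C) →ₗ[R] C := (LinearMap.snd R B C) ∘ₗ (LinearMap.snd R A (B × C))

def tri (f : D →ₗ[R] A) (g : D →ₗ[R] B) (h : D →ₗ[R] C) : D →ₗ[R] A × B × C :=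
  f.prod (g.prod h)

def qj₁ : (A × B × C × D) →ₗ[R] A := LinearMap.fst R A (B × C × D)
def qj₂ : (A × B × C × D) →ₗ[R] B := (LinearMap.fst R B (C × D)) ∘ₗ (LinearMap.snd R A (B × C × D))
def qj₃ : (A × B × C × D) →ₗ[R] C :=
  (LinearMap.fst R C D) ∘ₗ (LinearMap.snd R B (C × D)) ∘ₗ (LinearMap.snd R A (B × C × D))
def qj₄ : (A × B × C × D) →ₗ[R] D :=
  (LinearMap.snd R C D) ∘ₗ (LinearMap.snd R B (C × D)) ∘ₗ (LinearMap.snd R A (B × C × D))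

def quad (f : E →ₗ[R] A) (g : E →ₗ[R] B) (h : E →ₗ[R] C) (l : E →ₗ[R] D) :
    E →ₗ[R] A × B × C × D := f.prod (g.prod (h.prod l))

end ProdHelpers

/-- The data of an `S`-complex over `R`: graded modules `C` (irreducible summand) and
`𝖱` (reducible summand), together with the component maps of the differential
`d~ = [[d, 0, 0], [v, −d, δ₂], [δ₁, 0, r]]` with respect to `C~ = C ⊕ C[-1] ⊕ 𝖱`. -/
structure SCData (R : Type u) [CommRing R] : Type (u + 1) where
  Irr : GradedMod R
  Red : GradedMod R
  d : Irr.carrier →ₗ[R] Irr.carrier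
  v : Irr.carrier →ₗ[R] Irr.carrier
  δ₁ : Irr.carrier →ₗ[R] Red.carrier
  δ₂ : Red.carrier →ₗ[R] Irr.carrier
  r : Red.carrier →ₗ[R] Red.carrier

namespace SCData

/-- The five relations equivalent to `d~ ∘ d~ = 0`. -/
def Relations (S : SCData R) : Prop :=
  S.d ∘ₗ S.d = 0 ∧
  S.δ₁ ∘ₗ S.d + S.r ∘ₗ S.δ₁ = 0 ∧
  S.d ∘ₗ S.δ₂ - S.δ₂ ∘ₗ S.r = 0 ∧
  S.d ∘ₗ S.v - S.v ∘ₗ S.d - S.δ₂ ∘ₗ S.δ₁ = 0 ∧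
  S.r ∘ₗ S.r = 0

/-- The degree conditions making `d~` a degree `−1` map on `C~ = C ⊕ C[-1] ⊕ 𝖱`. -/
def Degrees (S : SCData R) : Prop :=
  S.Irr.IsDeg S.Irr (-1) S.d ∧ S.Irr.IsDeg S.Irr (-2) S.v ∧
  S.Irr.IsDeg S.Red (-1) S.δ₁ ∧ S.Red.IsDeg S.Irr (-2) S.δ₂ ∧
  S.Red.IsDeg S.Red (-1) S.r

/-- `S` is an `S`-complex. -/
def IsSComplex (S : SCData R) : Prop :=
  S.Irr.IsFGFree ∧ S.Red.IsFGFree ∧ S.Degrees ∧ S.Relations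

/-- `S` is `r`-perfect: the reducible summand is concentrated in even degrees
(which forces `r = 0` and `δ₁ ∘ v^i ∘ δ₂ = 0` for all `i ≥ 0`). -/
def RPerfect (S : SCData R) : Prop :=
  (∀ j : ℤ, Odd j → S.Red.grading j = ⊥) ∧ S.r = 0 ∧
    ∀ i : ℕ, S.δ₁ ∘ₗ lpow S.v i ∘ₗ S.δ₂ = 0

/-- The total graded module `C~ = C ⊕ C[-1] ⊕ 𝖱`. -/
def Tot (S : SCData R) : GradedMod R where
  carrier := S.Irr.carrier × S.Irr.carrier × S.Red.carrier
  grading j := (S.Irr.grading j).prod ((S.Irr.grading (j - 1)).prod (S.Red.grading j))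

/-- The total differential `d~(c, c', ρ) = (d c, v c − d c' + δ₂ ρ, δ₁ c + r ρ)`. -/
def totalDiff (S : SCData R) : S.Tot.carrier →ₗ[R] S.Tot.carrier :=
  tri (S.d ∘ₗ pj₁) (S.v ∘ₗ pj₁ - S.d ∘ₗ pj₂ + S.δ₂ ∘ₗ pj₃) (S.δ₁ ∘ₗ pj₁ + S.r ∘ₗ pj₃)

/-- The map `χ(c, c', ρ) = (0, c, 0)`. -/
def totalChi (S : SCData R) : S.Tot.carrier →ₗ[R] S.Tot.carrier :=
  tri 0 pj₁ 0

/-- The suspension `ΣC~`: `C_Σ = C[-2] ⊕ 𝖱[-1]`, `𝖱_Σ = 𝖱`, with the differential of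
Definition 2.9 of the paper. -/
def susp (S : SCData R) : SCData R where
  Irr := { carrier := S.Irr.carrier × S.Red.carrier
           grading := fun j => (S.Irr.grading (j - 2)).prod (S.Red.grading (j - 1)) }
  Red := S.Red
  d := LinearMap.prod
      (S.d ∘ₗ LinearMap.fst R S.Irr.carrier S.Red.carrier -
        S.δ₂ ∘ₗ LinearMap.snd R S.Irr.carrier S.Red.carrier)
      (-(S.r ∘ₗ LinearMap.snd R S.Irr.carrier S.Red.carrier))
  v := LinearMap.prod (S.v ∘ₗ LinearMap.fst R S.Irr.carrier S.Red.carrier)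
      (S.δ₁ ∘ₗ LinearMap.fst R S.Irr.carrier S.Red.carrier)
  δ₁ := LinearMap.snd R S.Irr.carrier S.Red.carrier
  δ₂ := LinearMap.prod (S.v ∘ₗ S.δ₂) (S.δ₁ ∘ₗ S.δ₂)
  r := S.r

/-- The negative suspension `Σ⁻¹C~`: `C_{Σ⁻¹} = C[2] ⊕ 𝖱[2]`, `𝖱_{Σ⁻¹} = 𝖱`. -/
def negSusp (S : SCData R) : SCData R where
  Irr := { carrier := S.Irr.carrier × S.Red.carrier
           grading := fun j => (S.Irr.grading (j + 2)).prod (S.Red.grading (j + 2)) }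
  Red := S.Red
  d := LinearMap.prod (S.d ∘ₗ LinearMap.fst R S.Irr.carrier S.Red.carrier)
      (S.δ₁ ∘ₗ LinearMap.fst R S.Irr.carrier S.Red.carrier +
        S.r ∘ₗ LinearMap.snd R S.Irr.carrier S.Red.carrier)
  v := LinearMap.prod (S.v ∘ₗ LinearMap.fst R S.Irr.carrier S.Red.carrier +
        S.δ₂ ∘ₗ LinearMap.snd R S.Irr.carrier S.Red.carrier) 0
  δ₁ := S.δ₁ ∘ₗ S.v ∘ₗ LinearMap.fst R S.Irr.carrier S.Red.carrier +
        S.δ₁ ∘ₗ S.δ₂ ∘ₗ LinearMap.snd R S.Irr.carrier S.Red.carrier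
  δ₂ := LinearMap.prod 0 LinearMap.id
  r := S.r

/-- `Σ^n`, the `n`-fold (negative) suspension. -/
def suspPow (S : SCData R) : ℤ → SCData R
  | Int.ofNat n => (fun X : SCData R => X.susp)^[n] S
  | Int.negSucc n => (fun X : SCData R => X.negSusp)^[n + 1] S

/-- The shifted `S`-complex `C~[n]`: gradings shifted, same differential and `χ`-map. -/
def shiftSC (S : SCData R) (n : ℤ) : SCData R where
  Irr := S.Irr.shift n
  Red := S.Red.shift n
  d := S.d
  v := S.v
  δ₁ := S.δ₁
  δ₂ := S.δ₂
  r := S.r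

end SCData

/-- A map of `S`-complexes in block form `[[λ, 0, 0], [μ, λ, Δ₂], [Δ₁, 0, ρ]]`
(equivalently, a `χ`-equivariant map `C~ → C~'`); used both for morphisms and
(with appropriate signs in the total interpretation) for homotopies. -/
structure SMap {R : Type u} [CommRing R] (S T : SCData R) : Type u where
  lam : S.Irr.carrier →ₗ[R] T.Irr.carrier
  mu : S.Irr.carrier →ₗ[R] T.Irr.carrier
  del1 : S.Irr.carrier →ₗ[R] T.Red.carrier
  del2 : S.Red.carrier →ₗ[R] T.Irr.carrier
  rho : S.Red.carrier →ₗ[R] T.Red.carrier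

namespace SMap

variable {S T U : SCData R}

/-- The component relations equivalent to `d~' λ~ = λ~ d~`. -/
def IsMor (f : SMap S T) : Prop :=
  T.d ∘ₗ f.lam - f.lam ∘ₗ S.d = 0 ∧
  f.del1 ∘ₗ S.d + f.rho ∘ₗ S.δ₁ - T.δ₁ ∘ₗ f.lam - T.r ∘ₗ f.del1 = 0 ∧
  T.d ∘ₗ f.del2 - T.δ₂ ∘ₗ f.rho + f.lam ∘ₗ S.δ₂ + f.del2 ∘ₗ S.r = 0 ∧
  f.mu ∘ₗ S.d + T.d ∘ₗ f.mu + f.lam ∘ₗ S.v - T.v ∘ₗ f.lam + f.del2 ∘ₗ S.δ₁ - T.δ₂ ∘ₗ f.del1 = 0 ∧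
  f.rho ∘ₗ S.r - T.r ∘ₗ f.rho = 0

/-- The components have the degrees of a degree `k` map of `S`-complexes. -/
def DegreesAt (f : SMap S T) (k : ℤ) : Prop :=
  S.Irr.IsDeg T.Irr k f.lam ∧ S.Irr.IsDeg T.Irr (k - 1) f.mu ∧
  S.Irr.IsDeg T.Red k f.del1 ∧ S.Red.IsDeg T.Irr (k - 1) f.del2 ∧
  S.Red.IsDeg T.Red k f.rho

/-- Composition of morphisms of `S`-complexes, componentwise. -/
def comp (g : SMap T U) (f : SMap S T) : SMap S U where
  lam := g.lam ∘ₗ f.lam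
  mu := g.lam ∘ₗ f.mu + g.mu ∘ₗ f.lam + g.del2 ∘ₗ f.del1
  del1 := g.del1 ∘ₗ f.lam + g.rho ∘ₗ f.del1
  del2 := g.lam ∘ₗ f.del2 + g.del2 ∘ₗ f.rho
  rho := g.rho ∘ₗ f.rho

/-- `K` is an `S`-chain homotopy from `f` to `g`, i.e. `d~' K~ + K~ d~ = λ~ - λ~'` where
`K~ = [[K, 0, 0], [L, -K, M₂], [M₁, 0, J]]`, in component form. -/
def IsHtpyFrom (K f g : SMap S T) : Prop :=
  T.d ∘ₗ K.lam + K.lam ∘ₗ S.d - f.lam + g.lam = 0 ∧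
  T.δ₁ ∘ₗ K.lam + T.r ∘ₗ K.del1 + K.del1 ∘ₗ S.d + K.rho ∘ₗ S.δ₁ - f.del1 + g.del1 = 0 ∧
  -(T.d ∘ₗ K.del2) + T.δ₂ ∘ₗ K.rho - K.lam ∘ₗ S.δ₂ + K.del2 ∘ₗ S.r - f.del2 + g.del2 = 0 ∧
  T.v ∘ₗ K.lam - T.d ∘ₗ K.mu + T.δ₂ ∘ₗ K.del1 + K.mu ∘ₗ S.d - K.lam ∘ₗ S.v + K.del2 ∘ₗ S.δ₁
    - f.mu + g.mu = 0 ∧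
  T.r ∘ₗ K.rho + K.rho ∘ₗ S.r - f.rho + g.rho = 0

end SMap

/-- The identity morphism. -/
def idMap (S : SCData R) : SMap S S where
  lam := LinearMap.id
  mu := 0
  del1 := 0
  del2 := 0
  rho := LinearMap.id

/-- The total map `C~ → C~'` of a morphism in block form. -/
def morTotal {S T : SCData R} (f : SMap S T) : S.Tot.carrier →ₗ[R] T.Tot.carrier :=
  tri (f.lam ∘ₗ pj₁) (f.mu ∘ₗ pj₁ + f.lam ∘ₗ pj₂ + f.del2 ∘ₗ pj₃) (f.del1 ∘ₗ pj₁ + f.rho ∘ₗ pj₃)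

/-- The total map `C~ → C~'` of a homotopy in block form. -/
def htpTotal {S T : SCData R} (K : SMap S T) : S.Tot.carrier →ₗ[R] T.Tot.carrier :=
  tri (K.lam ∘ₗ pj₁) (K.mu ∘ₗ pj₁ - K.lam ∘ₗ pj₂ + K.del2 ∘ₗ pj₃) (K.del1 ∘ₗ pj₁ + K.rho ∘ₗ pj₃)

/-- `S`-chain homotopy equivalence of `S`-complexes. -/
def SHomotopyEquiv (S T : SCData R) : Prop :=
  ∃ (f : SMap S T) (g : SMap T S) (H₁ : SMap S S) (H₂ : SMap T T),
    f.IsMor ∧ f.DegreesAt 0 ∧ g.IsMor ∧ g.DegreesAt 0 ∧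
    H₁.DegreesAt 1 ∧ SMap.IsHtpyFrom H₁ (g.comp f) (idMap S) ∧
    H₂.DegreesAt 1 ∧ SMap.IsHtpyFrom H₂ (f.comp g) (idMap T)

/-- Isomorphism of `S`-complexes: a (degree `0`) morphism with a two-sided inverse morphism. -/
def SIso (S T : SCData R) : Prop :=
  ∃ (f : SMap S T) (g : SMap T S), f.IsMor ∧ f.DegreesAt 0 ∧ g.IsMor ∧ g.DegreesAt 0 ∧
    g.comp f = idMap S ∧ f.comp g = idMap T

/-- The suspension `Σλ~` of a morphism `λ~`, in block form. -/
def suspMap {S T : SCData R} (f : SMap S T) : SMap S.susp T.susp where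
  lam := LinearMap.prod
      (f.lam ∘ₗ LinearMap.fst R S.Irr.carrier S.Red.carrier +
        f.del2 ∘ₗ LinearMap.snd R S.Irr.carrier S.Red.carrier)
      (f.rho ∘ₗ LinearMap.snd R S.Irr.carrier S.Red.carrier)
  mu := LinearMap.prod (f.mu ∘ₗ LinearMap.fst R S.Irr.carrier S.Red.carrier)
      (f.del1 ∘ₗ LinearMap.fst R S.Irr.carrier S.Red.carrier)
  del1 := 0
  del2 := LinearMap.prod (f.mu ∘ₗ S.δ₂ + T.v ∘ₗ f.del2) (f.del1 ∘ₗ S.δ₂ + T.δ₁ ∘ₗ f.del2)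
  rho := f.rho

/-- The suspension `ΣK~` of a homotopy `K~`, in block form. -/
def suspHtpy {S T : SCData R} (K : SMap S T) : SMap S.susp T.susp where
  lam := LinearMap.prod
      (K.lam ∘ₗ LinearMap.fst R S.Irr.carrier S.Red.carrier -
        K.del2 ∘ₗ LinearMap.snd R S.Irr.carrier S.Red.carrier)
      (-(K.rho ∘ₗ LinearMap.snd R S.Irr.carrier S.Red.carrier))
  mu := LinearMap.prod (K.mu ∘ₗ LinearMap.fst R S.Irr.carrier S.Red.carrier)
      (K.del1 ∘ₗ LinearMap.fst R S.Irr.carrier S.Red.carrier)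
  del1 := 0
  del2 := LinearMap.prod (T.v ∘ₗ K.del2 + K.mu ∘ₗ S.δ₂) (T.δ₁ ∘ₗ K.del2 + K.del1 ∘ₗ S.δ₂)
  rho := K.rho

/-- The sequence `τ_0 = ρ`, `τ_{i+1} = δ₁'v'^iΔ₂ + Δ₁v^iδ₂ + Σ_{j<i} δ₁'v'^j μ v^{i−1−j} δ₂`
attached to an (even degree) morphism between `r`-perfect `S`-complexes. -/
def tauSMap {S T : SCData R} (f : SMap S T) : ℕ → (S.Red.carrier →ₗ[R] T.Red.carrier)
  | 0 => f.rho
  | i + 1 =>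
      T.δ₁ ∘ₗ lpow T.v i ∘ₗ f.del2 + f.del1 ∘ₗ lpow S.v i ∘ₗ S.δ₂ +
        ∑ j ∈ Finset.range i, T.δ₁ ∘ₗ lpow T.v j ∘ₗ f.mu ∘ₗ lpow S.v (i - 1 - j) ∘ₗ S.δ₂

/-- Height `n` (for `n ≥ 0`): `τ_j = 0` for `0 ≤ j < n`. -/
def SMap.HasHeight {S T : SCData R} (f : SMap S T) (n : ℕ) : Prop :=
  ∀ j : ℕ, j < n → tauSMap f j = 0

/-- Strong height `n`: height `n` and `τ_n` an isomorphism. -/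
def SMap.StrongHeight {S T : SCData R} (f : SMap S T) (n : ℕ) : Prop :=
  f.HasHeight n ∧ Function.Bijective ⇑(tauSMap f n)

/-- The explicit model of the `n`-fold suspension `Σ^n C~` of an `r`-perfect `S`-complex:
`C_{Σ^n} = C[-2n] ⊕ ⊕_{i=0}^{n-1} 𝖱[-2i-1]` (the `m`-th factor of `Fin n → 𝖱` being
`𝖱[-2(n-1-m)-1]`), `𝖱_{Σ^n} = 𝖱`, with the components of the differential as in
Subsection 2.4 of the paper. -/
def SCData.suspN (S : SCData R) (n : ℕ) : SCData R where
  Irr := { carrier := S.Irr.carrier × (Fin n → S.Red.carrier)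
           grading := fun j => (S.Irr.grading (j - 2 * (n : ℤ))).prod
             (Submodule.pi Set.univ fun m : Fin n =>
               S.Red.grading (j - 2 * (((n - 1 - (m : ℕ) : ℕ)) : ℤ) - 1)) }
  Red := S.Red
  d := LinearMap.prod
      (S.d ∘ₗ LinearMap.fst R S.Irr.carrier (Fin n → S.Red.carrier) -
        ∑ m : Fin n, lpow S.v (m : ℕ) ∘ₗ S.δ₂ ∘ₗ LinearMap.proj m ∘ₗ
          LinearMap.snd R S.Irr.carrier (Fin n → S.Red.carrier)) 0
  v := LinearMap.prod (S.v ∘ₗ LinearMap.fst R S.Irr.carrier (Fin n → S.Red.carrier))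
      (LinearMap.pi fun m : Fin n =>
        if (m : ℕ) = 0 then S.δ₁ ∘ₗ LinearMap.fst R S.Irr.carrier (Fin n → S.Red.carrier)
        else LinearMap.proj (⟨(m : ℕ) - 1, lt_of_le_of_lt (Nat.sub_le _ _) m.isLt⟩ : Fin n) ∘ₗ
          LinearMap.snd R S.Irr.carrier (Fin n → S.Red.carrier))
  δ₁ := if h : 0 < n then
      LinearMap.proj (⟨n - 1, Nat.sub_lt h Nat.one_pos⟩ : Fin n) ∘ₗ
        LinearMap.snd R S.Irr.carrier (Fin n → S.Red.carrier)
    else 0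
  δ₂ := LinearMap.prod (lpow S.v n ∘ₗ S.δ₂) 0
  r := 0

/-- The natural morphism `ι~_n : C~ → Σ^n C~`, with `λ`-component `c ↦ (c, 0, …, 0)` and
`Δ₂`-component `θ ↦ (0, θ, 0, …, 0)`. -/
def iotaN (S : SCData R) (n : ℕ) : SMap S (S.suspN n) where
  lam := LinearMap.prod LinearMap.id 0
  mu := 0
  del1 := 0
  del2 := LinearMap.prod 0 (LinearMap.pi fun m : Fin n => if (m : ℕ) = 0 then LinearMap.id else 0)
  rho := 0

/-- The data of a generalized height morphism between `r`-perfect `S`-complexes: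
the four maps `λ, μ, Δ₁, Δ₂` and the sequence `τ_i` for `i ∈ ℤ`. -/
structure HMor {R : Type u} [CommRing R] (S T : SCData R) : Type u where
  lam : S.Irr.carrier →ₗ[R] T.Irr.carrier
  mu : S.Irr.carrier →ₗ[R] T.Irr.carrier
  del1 : S.Irr.carrier →ₗ[R] T.Red.carrier
  del2 : S.Red.carrier →ₗ[R] T.Irr.carrier
  tau : ℤ → (S.Red.carrier →ₗ[R] T.Red.carrier)

/-- `f` is a height `n` morphism of (even) degree `k` between `r`-perfect `S`-complexes. -/
def HMor.IsHeightMor {S T : SCData R} (f : HMor S T) (n : ℤ) (k : ℤ) : Prop :=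
  Even k ∧
  S.Irr.IsDeg T.Irr k f.lam ∧ S.Irr.IsDeg T.Irr (k - 1) f.mu ∧
  S.Irr.IsDeg T.Red k f.del1 ∧ S.Red.IsDeg T.Irr (k - 1) f.del2 ∧
  (∀ i : ℤ, S.Red.IsDeg T.Red (k - 2 * i) (f.tau i)) ∧
  (∀ i : ℤ, i < n → f.tau i = 0) ∧
  (∀ i : ℕ, f.tau ((i : ℤ) + 1) =
      T.δ₁ ∘ₗ lpow T.v i ∘ₗ f.del2 + f.del1 ∘ₗ lpow S.v i ∘ₗ S.δ₂ +
        ∑ j ∈ Finset.range i, T.δ₁ ∘ₗ lpow T.v j ∘ₗ f.mu ∘ₗ lpow S.v (i - 1 - j) ∘ₗ S.δ₂) ∧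
  (T.d ∘ₗ f.lam - f.lam ∘ₗ S.d -
      ∑ᶠ i : ℕ, ∑ j ∈ Finset.range (i + 1),
        lpow T.v j ∘ₗ T.δ₂ ∘ₗ f.tau (-((i : ℤ) + 1)) ∘ₗ S.δ₁ ∘ₗ lpow S.v (i - j) = 0) ∧
  (-(T.δ₁ ∘ₗ f.lam) + f.del1 ∘ₗ S.d + ∑ᶠ i : ℕ, f.tau (-(i : ℤ)) ∘ₗ S.δ₁ ∘ₗ lpow S.v i = 0) ∧
  (f.lam ∘ₗ S.δ₂ + T.d ∘ₗ f.del2 - ∑ᶠ i : ℕ, lpow T.v i ∘ₗ T.δ₂ ∘ₗ f.tau (-(i : ℤ)) = 0) ∧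
  (f.mu ∘ₗ S.d + T.d ∘ₗ f.mu + f.lam ∘ₗ S.v - T.v ∘ₗ f.lam + f.del2 ∘ₗ S.δ₁ - T.δ₂ ∘ₗ f.del1 = 0)

/-- Composition of generalized height morphisms (Definition 2.23 of the paper). -/
noncomputable def HMor.compH {S T U : SCData R} (g : HMor T U) (f : HMor S T) : HMor S U where
  lam := g.lam ∘ₗ f.lam
    + (∑ᶠ i : ℕ, ∑ j ∈ Finset.range (i + 1),
        lpow U.v j ∘ₗ U.δ₂ ∘ₗ g.tau (-((i : ℤ) + 1)) ∘ₗ f.del1 ∘ₗ lpow S.v (i - j))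
    + (∑ᶠ i : ℕ, ∑ j ∈ Finset.range (i + 1),
        lpow U.v j ∘ₗ g.del2 ∘ₗ f.tau (-((i : ℤ) + 1)) ∘ₗ S.δ₁ ∘ₗ lpow S.v (i - j))
    + (∑ᶠ i : ℕ, ∑ j ∈ Finset.range (i + 1), ∑ l ∈ Finset.range (i - j + 1),
        lpow U.v j ∘ₗ U.δ₂ ∘ₗ g.tau (-((i : ℤ) + 2)) ∘ₗ T.δ₁ ∘ₗ lpow T.v l ∘ₗ f.mu ∘ₗ
          lpow S.v (i - j - l))
    + (∑ᶠ i : ℕ, ∑ j ∈ Finset.range (i + 1), ∑ l ∈ Finset.range (i - j + 1),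
        lpow U.v j ∘ₗ g.mu ∘ₗ lpow T.v l ∘ₗ T.δ₂ ∘ₗ f.tau (-((i : ℤ) + 2)) ∘ₗ S.δ₁ ∘ₗ
          lpow S.v (i - j - l))
  mu := g.lam ∘ₗ f.mu + g.mu ∘ₗ f.lam + g.del2 ∘ₗ f.del1
  del1 := g.del1 ∘ₗ f.lam + (∑ᶠ i : ℕ, g.tau (-(i : ℤ)) ∘ₗ f.del1 ∘ₗ lpow S.v i)
    + (∑ᶠ i : ℕ, ∑ j ∈ Finset.range (i + 1),
        g.tau (-((i : ℤ) + 1)) ∘ₗ T.δ₁ ∘ₗ lpow T.v j ∘ₗ f.mu ∘ₗ lpow S.v (i - j))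
  del2 := g.lam ∘ₗ f.del2 + (∑ᶠ i : ℕ, lpow U.v i ∘ₗ g.del2 ∘ₗ f.tau (-(i : ℤ)))
    + (∑ᶠ i : ℕ, ∑ j ∈ Finset.range (i + 1),
        lpow U.v j ∘ₗ g.mu ∘ₗ lpow T.v (i - j) ∘ₗ T.δ₂ ∘ₗ f.tau (-((i : ℤ) + 1)))
  tau := fun i => ∑ᶠ l : ℤ, g.tau (i - l) ∘ₗ f.tau l

/-- The strong height `−n` morphism `κ~_n : Σ^n C~ → C~`. -/
def kappaN (T : SCData R) (n : ℕ) : HMor (T.suspN n) T where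
  lam := LinearMap.fst R T.Irr.carrier (Fin n → T.Red.carrier)
  mu := 0
  del1 := 0
  del2 := 0
  tau := fun i => if i = -(n : ℤ) then LinearMap.id else 0

/-- An (even degree) morphism of `S`-complexes, regarded as a generalized height morphism. -/
def SMap.toHMor {S T : SCData R} (f : SMap S T) : HMor S T where
  lam := f.lam
  mu := f.mu
  del1 := f.del1
  del2 := f.del2
  tau := fun i => if 0 ≤ i then tauSMap f i.toNat else 0

/-- The height `0` morphism `λ~' : C~ → Σ^n C~'` associated to a height `−n` morphism
(Proposition 2.25 of the paper). -/
def heightNegToSusp {S T : SCData R} (f : HMor S T) (n : ℕ) : SMap S (T.suspN n) where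
  lam := LinearMap.prod f.lam
    (LinearMap.pi fun m : Fin n =>
      ∑ i ∈ Finset.Icc ((m : ℕ) + 1) n, f.tau (-(i : ℤ)) ∘ₗ S.δ₁ ∘ₗ lpow S.v (i - 1 - (m : ℕ)))
  mu := LinearMap.prod f.mu (LinearMap.pi fun m : Fin n => if (m : ℕ) = 0 then f.del1 else 0)
  del1 := 0
  del2 := LinearMap.prod f.del2 (LinearMap.pi fun m : Fin n => f.tau (-((m : ℕ) : ℤ)))
  rho := f.tau (-(n : ℤ))

/-- The morphism `ι~₁ : C~ → ΣC~`. -/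
def iotaOne (S : SCData R) : SMap S S.susp where
  lam := LinearMap.prod LinearMap.id 0
  mu := 0
  del1 := 0
  del2 := LinearMap.prod 0 LinearMap.id
  rho := 0

/-- The morphism `λ~'' : ΣC~' → C~''` associated to an odd degree morphism `λ~'` together
with the map `ν' : 𝖱' → 𝖱''` (Subsection 2.6 of the paper). -/
def lambdaSecond {S T : SCData R} (f : SMap S T) (nu : S.Red.carrier →ₗ[R] T.Red.carrier) :
    SMap S.susp T where
  lam := f.lam ∘ₗ LinearMap.fst R S.Irr.carrier S.Red.carrier +
    f.del2 ∘ₗ LinearMap.snd R S.Irr.carrier S.Red.carrier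
  mu := f.mu ∘ₗ LinearMap.fst R S.Irr.carrier S.Red.carrier
  del1 := f.del1 ∘ₗ LinearMap.fst R S.Irr.carrier S.Red.carrier +
    nu ∘ₗ LinearMap.snd R S.Irr.carrier S.Red.carrier
  del2 := f.mu ∘ₗ S.δ₂ + T.v ∘ₗ f.del2 + T.δ₂ ∘ₗ nu
  rho := 0

/-- The morphism `λ~₁ : C~ → ΣC~'` associated to height `−1` morphism data
`(λ, μ, Δ₁, Δ₂, τ₀, τ₋₁)`, in block form
`[[λ, 0, 0], [τ₋₁δ₁, 0, 0], [μ, λ, Δ₂], [Δ₁, τ₋₁δ₁, τ₀], [0, 0, τ₋₁]]`. -/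
def hNegOneSusp {S T : SCData R} (lam0 mu0 : S.Irr.carrier →ₗ[R] T.Irr.carrier)
    (del10 : S.Irr.carrier →ₗ[R] T.Red.carrier) (del20 : S.Red.carrier →ₗ[R] T.Irr.carrier)
    (tau0 taum1 : S.Red.carrier →ₗ[R] T.Red.carrier) : SMap S T.susp where
  lam := LinearMap.prod lam0 (taum1 ∘ₗ S.δ₁)
  mu := LinearMap.prod mu0 del10
  del1 := 0
  del2 := LinearMap.prod del20 tau0
  rho := taum1

/-- The mapping cone of a degree `k` morphism `λ~ : C~ → C~'`, as an `S`-complex;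
its underlying graded module is `C~[-1-k] ⊕ C~'`. -/
def coneSC {S T : SCData R} (f : SMap S T) (k : ℤ) : SCData R where
  Irr := { carrier := S.Irr.carrier × T.Irr.carrier
           grading := fun j => (S.Irr.grading (j - 1 - k)).prod (T.Irr.grading j) }
  Red := { carrier := S.Red.carrier × T.Red.carrier
           grading := fun j => (S.Red.grading (j - 1 - k)).prod (T.Red.grading j) }
  d := LinearMap.prod (-(S.d ∘ₗ LinearMap.fst R S.Irr.carrier T.Irr.carrier))
      (f.lam ∘ₗ LinearMap.fst R S.Irr.carrier T.Irr.carrier +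
        T.d ∘ₗ LinearMap.snd R S.Irr.carrier T.Irr.carrier)
  v := LinearMap.prod (S.v ∘ₗ LinearMap.fst R S.Irr.carrier T.Irr.carrier)
      (f.mu ∘ₗ LinearMap.fst R S.Irr.carrier T.Irr.carrier +
        T.v ∘ₗ LinearMap.snd R S.Irr.carrier T.Irr.carrier)
  δ₁ := LinearMap.prod (-(S.δ₁ ∘ₗ LinearMap.fst R S.Irr.carrier T.Irr.carrier))
      (f.del1 ∘ₗ LinearMap.fst R S.Irr.carrier T.Irr.carrier +
        T.δ₁ ∘ₗ LinearMap.snd R S.Irr.carrier T.Irr.carrier)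
  δ₂ := LinearMap.prod (S.δ₂ ∘ₗ LinearMap.fst R S.Red.carrier T.Red.carrier)
      (f.del2 ∘ₗ LinearMap.fst R S.Red.carrier T.Red.carrier +
        T.δ₂ ∘ₗ LinearMap.snd R S.Red.carrier T.Red.carrier)
  r := LinearMap.prod (-(S.r ∘ₗ LinearMap.fst R S.Red.carrier T.Red.carrier))
      (f.rho ∘ₗ LinearMap.fst R S.Red.carrier T.Red.carrier +
        T.r ∘ₗ LinearMap.snd R S.Red.carrier T.Red.carrier)

/-- Direct sum of `S`-complexes. -/
def sumSC (S T : SCData R) : SCData R where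
  Irr := S.Irr.prodGM T.Irr
  Red := S.Red.prodGM T.Red
  d := S.d.prodMap T.d
  v := S.v.prodMap T.v
  δ₁ := S.δ₁.prodMap T.δ₁
  δ₂ := S.δ₂.prodMap T.δ₂
  r := S.r.prodMap T.r

/-- The dual `S`-complex `C~†`, defined using sign operators on the dual graded modules:
`m†(f) = −ε(f) f ∘ m`, with the roles of `δ₁` and `δ₂` interchanged. -/
def dualSC (S : SCData R)
    (eCd : Module.Dual R S.Irr.carrier →ₗ[R] Module.Dual R S.Irr.carrier)
    (eRd : Module.Dual R S.Red.carrier →ₗ[R] Module.Dual R S.Red.carrier) : SCData R where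
  Irr := S.Irr.dualGM
  Red := S.Red.dualGM
  d := -(S.d.dualMap ∘ₗ eCd)
  v := -(S.v.dualMap ∘ₗ eCd)
  δ₁ := -(S.δ₂.dualMap ∘ₗ eCd)
  δ₂ := -(S.δ₁.dualMap ∘ₗ eRd)
  r := -(S.r.dualMap ∘ₗ eRd)

/-- The rank-one graded module `R`, concentrated in degree `n`. -/
def unitGM (R : Type u) [CommRing R] (n : ℤ) : GradedMod R where
  carrier := R
  grading j := if j = n then ⊤ else ⊥

/-- The `S`-complex `O~(1)`: `C = R` in degree `1`, `𝖱 = R` in degree `0`, `δ₁ = id`. -/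
def O1 (R : Type u) [CommRing R] : SCData R where
  Irr := unitGM R 1
  Red := unitGM R 0
  d := 0
  v := 0
  δ₁ := LinearMap.id
  δ₂ := 0
  r := 0

/-- The `S`-complex `O~(-1)`: `C = R` in degree `-2`, `𝖱 = R` in degree `0`, `δ₂ = id`. -/
def Om1 (R : Type u) [CommRing R] : SCData R where
  Irr := unitGM R (-2)
  Red := unitGM R 0
  d := 0
  v := 0
  δ₁ := 0
  δ₂ := LinearMap.id
  r := 0

/-- The `S`-complex `O~(0)`: `C = 0`, `𝖱 = R` in degree `0`, zero differential. -/
def O0 (R : Type u) [CommRing R] : SCData R where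
  Irr := { carrier := ↥(⊥ : Submodule R R), grading := fun _ => ⊥ }
  Red := unitGM R 0
  d := 0
  v := 0
  δ₁ := 0
  δ₂ := 0
  r := 0

/-- The `S`-complex representation of the tensor product `C~ ⊗ C~'` of `S`-complexes
(Subsection 2.2 of the paper), where `eC`, `eR` are the sign operators of the first factor:
`C^⊗ = (C⊗C') ⊕ (C⊗C')[-1] ⊕ (C⊗𝖱') ⊕ (𝖱⊗C')` and `𝖱^⊗ = 𝖱⊗𝖱'`. -/
noncomputable def tensorRep (S T : SCData R)
    (eC : S.Irr.carrier →ₗ[R] S.Irr.carrier) (eR : S.Red.carrier →ₗ[R] S.Red.carrier) :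
    SCData R where
  Irr := (S.Irr.tensorGM T.Irr).prodGM (((S.Irr.tensorGM T.Irr).shift (-1)).prodGM
      ((S.Irr.tensorGM T.Red).prodGM (S.Red.tensorGM T.Irr)))
  Red := S.Red.tensorGM T.Red
  d := quad
      (TensorProduct.map S.d LinearMap.id ∘ₗ qj₁ + TensorProduct.map eC T.d ∘ₗ qj₁)
      (TensorProduct.map (-(eC ∘ₗ S.v)) LinearMap.id ∘ₗ qj₁ + TensorProduct.map eC T.v ∘ₗ qj₁
        + TensorProduct.map S.d LinearMap.id ∘ₗ qj₂ - TensorProduct.map eC T.d ∘ₗ qj₂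
        + TensorProduct.map eC T.δ₂ ∘ₗ qj₃
        + TensorProduct.map (-(eC ∘ₗ S.δ₂)) LinearMap.id ∘ₗ qj₄)
      (TensorProduct.map eC T.δ₁ ∘ₗ qj₁ + TensorProduct.map S.d LinearMap.id ∘ₗ qj₃
        + TensorProduct.map eC T.r ∘ₗ qj₃)
      (TensorProduct.map S.δ₁ LinearMap.id ∘ₗ qj₁ + TensorProduct.map eR T.d ∘ₗ qj₄
        + TensorProduct.map S.r LinearMap.id ∘ₗ qj₄)
  v := quad
      (TensorProduct.map S.v LinearMap.id ∘ₗ qj₁ + TensorProduct.map S.δ₂ LinearMap.id ∘ₗ qj₄)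
      (TensorProduct.map S.v LinearMap.id ∘ₗ qj₂)
      (TensorProduct.map S.v LinearMap.id ∘ₗ qj₃)
      (TensorProduct.map (eR ∘ₗ S.δ₁) LinearMap.id ∘ₗ qj₂ + TensorProduct.map LinearMap.id T.v ∘ₗ qj₄)
  δ₁ := TensorProduct.map S.δ₁ LinearMap.id ∘ₗ qj₃ + TensorProduct.map eR T.δ₁ ∘ₗ qj₄
  δ₂ := quad 0 0 (TensorProduct.map S.δ₂ LinearMap.id) (TensorProduct.map LinearMap.id T.δ₂)
  r := TensorProduct.map S.r LinearMap.id + TensorProduct.map eR T.r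

/-- Homology of an endomorphism (thought of as a differential): `ker D / im D`. -/
abbrev homologyOf {M : Type u} [AddCommGroup M] [Module R M] (D : M →ₗ[R] M) : Type u :=
  ↥(LinearMap.ker D) ⧸
    Submodule.comap (LinearMap.ker D).subtype (LinearMap.range D)

/-- The map induced on homology by a chain map. -/
def inducedMap {M N : Type u} [AddCommGroup M] [Module R M] [AddCommGroup N] [Module R N]
    (DM : M →ₗ[R] M) (DN : N →ₗ[R] N) (f : M →ₗ[R] N) (h : DN ∘ₗ f = f ∘ₗ DM) :
    homologyOf DM →ₗ[R] homologyOf DN :=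
  Submodule.mapQ _ _
    (f.restrict (p := LinearMap.ker DM) (q := LinearMap.ker DN) (fun x hx => by
      have h1 : DN (f x) = f (DM x) := by
        have h2 := LinearMap.congr_fun h x
        simpa using h2
      have hx0 : DM x = 0 := LinearMap.mem_ker.mp hx
      simp [LinearMap.mem_ker, h1, hx0]))
    (by
      intro x hx
      simp only [Submodule.mem_comap] at hx ⊢
      obtain ⟨y, hy⟩ := hx
      refine ⟨f y, ?_⟩
      have h1 : DN (f y) = f (DM y) := by
        have h2 := LinearMap.congr_fun h y
        simpa using h2
      simp only [Submodule.coe_subtype] at hy ⊢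
      rw [LinearMap.restrict_apply]
      rw [h1, hy])

/-- The degree `j` homology of a graded module with a (degree `-1`) differential. -/
abbrev gradedHomology (M : GradedMod R) (D : M.carrier →ₗ[R] M.carrier) (j : ℤ) : Type u :=
  ↥(M.grading j ⊓ LinearMap.ker D) ⧸
    Submodule.comap (M.grading j ⊓ LinearMap.ker D).subtype ((M.grading (j + 1)).map D)

/-- The Euler characteristic `Σ_j (-1)^j rk_R M_j` of a graded module. -/
noncomputable def eulerChar (M : GradedMod R) : ℤ :=
  ∑ᶠ j : ℤ, (if Even j then (1 : ℤ) else -1) * (Module.finrank R ↥(M.grading j) : ℤ)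

/-- The small equivariant complex `Ĉ = C[-1] ⊕ 𝖱[x]`, with `𝖱[x]` modelled as `ℕ →₀ 𝖱`. -/
abbrev hatC (S : SCData R) : Type u := S.Irr.carrier × (ℕ →₀ S.Red.carrier)

/-- The differential `𝔡̂(α, θxⁱ) = (dα − vⁱδ₂θ, 0)`. -/
noncomputable def hatD (S : SCData R) : hatC S →ₗ[R] hatC S :=
  LinearMap.prod
    (S.d ∘ₗ LinearMap.fst R S.Irr.carrier (ℕ →₀ S.Red.carrier) -
      (Finsupp.lsum ℕ fun i : ℕ => lpow S.v i ∘ₗ S.δ₂) ∘ₗ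
        LinearMap.snd R S.Irr.carrier (ℕ →₀ S.Red.carrier))
    0

/-- The `x`-action `x·(α, θxⁱ) = (vα, δ₁α + θx^{i+1})` on `Ĉ`. -/
noncomputable def hatX (S : SCData R) : hatC S →ₗ[R] hatC S :=
  LinearMap.prod (S.v ∘ₗ LinearMap.fst R S.Irr.carrier (ℕ →₀ S.Red.carrier))
    (Finsupp.lsingle 0 ∘ₗ S.δ₁ ∘ₗ LinearMap.fst R S.Irr.carrier (ℕ →₀ S.Red.carrier) +
      Finsupp.lmapDomain S.Red.carrier R (fun i => i + 1) ∘ₗ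
        LinearMap.snd R S.Irr.carrier (ℕ →₀ S.Red.carrier))

/-- The small equivariant complex `Č = C ⊕ 𝖱[[x⁻¹,x]/𝖱[x]`, the tail modelled as `ℕ → 𝖱`
(the `m`-th coordinate is the coefficient of `x^{-m-1}`). -/
abbrev checkC (S : SCData R) : Type u := S.Irr.carrier × (ℕ → S.Red.carrier)

/-- The differential `𝔡̌(α, θxⁱ) = (dα, Σ_{j≤-1} δ₁v^{−j−1}(α)xʲ)`. -/
noncomputable def checkD (S : SCData R) : checkC S →ₗ[R] checkC S :=
  LinearMap.prod (S.d ∘ₗ LinearMap.fst R S.Irr.carrier (ℕ → S.Red.carrier))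
    (LinearMap.pi fun m : ℕ =>
      S.δ₁ ∘ₗ lpow S.v m ∘ₗ LinearMap.fst R S.Irr.carrier (ℕ → S.Red.carrier))

/-- The `x`-action on `Č`. -/
noncomputable def checkX (S : SCData R) : checkC S →ₗ[R] checkC S :=
  LinearMap.prod
    (S.v ∘ₗ LinearMap.fst R S.Irr.carrier (ℕ → S.Red.carrier) +
      S.δ₂ ∘ₗ LinearMap.proj 0 ∘ₗ LinearMap.snd R S.Irr.carrier (ℕ → S.Red.carrier))
    (LinearMap.pi fun m : ℕ =>
      LinearMap.proj (m + 1) ∘ₗ LinearMap.snd R S.Irr.carrier (ℕ → S.Red.carrier))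

/-- The module `𝖱[[x⁻¹,x]` of Laurent series with finitely many positive powers, modelled
as (polynomial part, tail): `(ℕ →₀ 𝖱) × (ℕ → 𝖱)`. -/
abbrev barC (S : SCData R) : Type u := (ℕ →₀ S.Red.carrier) × (ℕ → S.Red.carrier)

/-- Multiplication by `x` on `𝖱[[x⁻¹,x]`. -/
noncomputable def barX (S : SCData R) : barC S →ₗ[R] barC S :=
  LinearMap.prod
    (Finsupp.lsingle 0 ∘ₗ LinearMap.proj 0 ∘ₗ
        LinearMap.snd R (ℕ →₀ S.Red.carrier) (ℕ → S.Red.carrier) +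
      Finsupp.lmapDomain S.Red.carrier R (fun i => i + 1) ∘ₗ
        LinearMap.fst R (ℕ →₀ S.Red.carrier) (ℕ → S.Red.carrier))
    (LinearMap.pi fun m : ℕ =>
      LinearMap.proj (m + 1) ∘ₗ LinearMap.snd R (ℕ →₀ S.Red.carrier) (ℕ → S.Red.carrier))

/-- The chain map `𝔦 : Ĉ → 𝖱[[x⁻¹,x]`, `(α, θ) ↦ Σ_{i≤-1} δ₁v^{−i−1}(α)xⁱ + θ`. -/
noncomputable def mapI (S : SCData R) : hatC S →ₗ[R] barC S :=
  LinearMap.prod (LinearMap.snd R S.Irr.carrier (ℕ →₀ S.Red.carrier))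
    (LinearMap.pi fun m : ℕ =>
      S.δ₁ ∘ₗ lpow S.v m ∘ₗ LinearMap.fst R S.Irr.carrier (ℕ →₀ S.Red.carrier))

/-- The chain map `𝔧 : Č → Ĉ`, `(α, ·) ↦ (−α, 0)`. -/
noncomputable def mapJ (S : SCData R) : checkC S →ₗ[R] hatC S :=
  LinearMap.prod (-(LinearMap.fst R S.Irr.carrier (ℕ → S.Red.carrier))) 0

/-- The chain map `𝔭 : 𝖱[[x⁻¹,x] → Č`, `Σθᵢxⁱ ↦ (Σ_{i≥0} vⁱδ₂θᵢ, Σ_{i≤-1} θᵢxⁱ)`. -/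
noncomputable def mapP (S : SCData R) : barC S →ₗ[R] checkC S :=
  LinearMap.prod
    ((Finsupp.lsum ℕ fun i : ℕ => lpow S.v i ∘ₗ S.δ₂) ∘ₗ
      LinearMap.fst R (ℕ →₀ S.Red.carrier) (ℕ → S.Red.carrier))
    (LinearMap.snd R (ℕ →₀ S.Red.carrier) (ℕ → S.Red.carrier))

/-- The coefficient of `xᵉ`, as a linear map `𝖱[[x⁻¹,x] → 𝖱`. -/
noncomputable def coeffLM (S : SCData R) (e : ℤ) : barC S →ₗ[R] S.Red.carrier :=
  if 0 ≤ e then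
    Finsupp.lapply e.toNat ∘ₗ LinearMap.fst R (ℕ →₀ S.Red.carrier) (ℕ → S.Red.carrier)
  else
    LinearMap.proj (-e - 1).toNat ∘ₗ LinearMap.snd R (ℕ →₀ S.Red.carrier) (ℕ → S.Red.carrier)

/-- `𝔍(C~) ⊆ 𝖱[[x⁻¹,x]`, the image of `i⋆ : Ĥ → 𝖱[[x⁻¹,x]` (equal to `𝔦(ker 𝔡̂)`). -/
noncomputable def Jmod (S : SCData R) : Submodule R (barC S) :=
  (LinearMap.ker (hatD S)).map (mapI S)

/-- `J_i(C~) = { a₀ ∈ 𝖱 | ∃ a₀x^{-i} + a₋₁x^{-i-1} + ⋯ ∈ 𝔍(C~) }`. -/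
noncomputable def Jset (S : SCData R) (i : ℤ) : Submodule R S.Red.carrier :=
  ((Jmod S) ⊓ ⨅ (e : ℤ) (_ : -i < e), LinearMap.ker (coeffLM S e)).map (coeffLM S (-i))

/-- The function `d_{C~}(i) = rk_R J_i(C~)`. -/
noncomputable def dFun (S : SCData R) (i : ℤ) : ℕ := Module.finrank R ↥(Jset S i)

section lpow

variable {M : Type u} [AddCommGroup M] [Module R M] (f : M →ₗ[R] M)

theorem lpow_zero_apply (x : M) : lpow f 0 x = x := rfl

theorem lpow_succ_apply (m : ℕ) (x : M) : lpow f (m + 1) x = f (lpow f m x) := rfl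

end lpow

theorem GradedMod.isDeg_iff {M N : GradedMod R} {k : ℤ} {f : M.carrier →ₗ[R] N.carrier} :
    M.IsDeg N k f ↔ ∀ i, ∀ x ∈ M.grading i, f x ∈ N.grading (i + k) :=
  forall_congr' fun _ => Submodule.map_le_iff_le_comap

namespace GradedMod.IsDeg

variable {M N P : GradedMod R}

theorem mem {k : ℤ} {f : M.carrier →ₗ[R] N.carrier} (hf : M.IsDeg N k f) {i j : ℤ}
    (hij : i + k = j) {x : M.carrier} (hx : x ∈ M.grading i) : f x ∈ N.grading j :=
  hij ▸ isDeg_iff.1 hf i x hx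

theorem comp {a b c : ℤ} {g : N.carrier →ₗ[R] P.carrier} {f : M.carrier →ₗ[R] N.carrier}
    (hg : N.IsDeg P b g) (hf : M.IsDeg N a f) (hc : a + b = c) : M.IsDeg P c (g ∘ₗ f) :=
  isDeg_iff.2 fun _ _ hx => hg.mem (by omega) (hf.mem rfl hx)

theorem add {k : ℤ} {f g : M.carrier →ₗ[R] N.carrier} (hf : M.IsDeg N k f)
    (hg : M.IsDeg N k g) : M.IsDeg N k (f + g) :=
  isDeg_iff.2 fun _ _ hx => Submodule.add_mem _ (hf.mem rfl hx) (hg.mem rfl hx)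

theorem zero (k : ℤ) : M.IsDeg N k 0 :=
  isDeg_iff.2 fun _ _ _ => Submodule.zero_mem _

theorem lpow {k : ℤ} {f : M.carrier →ₗ[R] M.carrier} (hf : M.IsDeg M k f) (m : ℕ) :
    M.IsDeg M (m * k) (lpow f m) := by
  induction m with
  | zero => exact isDeg_iff.2 fun i x hx => by simpa [_root_.lpow] using hx
  | succ m ih => exact hf.comp ih (by push_cast; ring)

end GradedMod.IsDeg

namespace SCData

theorem isDeg_lpow_v_delta2 {S : SCData R} (hS : S.Degrees) (m : ℕ) :
    S.Red.IsDeg S.Irr (-2 * m - 2) (lpow S.v m ∘ₗ S.δ₂) :=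
  (hS.2.1.lpow m).comp hS.2.2.2.1 (by ring)

theorem d_lpow_v_delta2 {S : SCData R} (hS : S.Relations) (hr : S.RPerfect) (m : ℕ)
    (θ : S.Red.carrier) : S.d (lpow S.v m (S.δ₂ θ)) = 0 := by
  obtain ⟨-, -, hδ₂, hv, -⟩ := hS
  induction m with
  | zero => simpa [hr.2.1, lpow_zero_apply] using LinearMap.congr_fun hδ₂ θ
  | succ m ih =>
    have hcomm := LinearMap.congr_fun hv (lpow S.v m (S.δ₂ θ))
    have hδ := LinearMap.congr_fun (hr.2.2 m) θ
    simp only [LinearMap.sub_apply, LinearMap.comp_apply, LinearMap.zero_apply] at hcomm hδ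
    simpa [ih, hδ, lpow_succ_apply] using hcomm

section suspN

variable (S : SCData R) (n : ℕ)

theorem suspN_d_apply (c : S.Irr.carrier) (θ : Fin n → S.Red.carrier) :
    (S.suspN n).d (c, θ) = (S.d c - ∑ m : Fin n, lpow S.v m (S.δ₂ (θ m)), 0) := by
  refine Prod.ext ?_ rfl
  change S.d c - (∑ m : Fin n, lpow S.v (m : ℕ) ∘ₗ S.δ₂ ∘ₗ LinearMap.proj m ∘ₗ
    LinearMap.snd R S.Irr.carrier (Fin n → S.Red.carrier)) (c, θ) = _
  simp [LinearMap.sum_apply]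

theorem suspN_v_apply (c : S.Irr.carrier) (θ : Fin (n + 1) → S.Red.carrier) :
    (S.suspN (n + 1)).v (c, θ) =
      (S.v c, Fin.cons (α := fun _ => S.Red.carrier) (S.δ₁ c) fun m : Fin n => θ m.castSucc) := by
  refine Prod.ext rfl (funext fun m => ?_)
  refine Fin.cases rfl (fun m => rfl) m

theorem suspN_delta1_apply (c : S.Irr.carrier) (θ : Fin (n + 1) → S.Red.carrier) :
    (S.suspN (n + 1)).δ₁ (c, θ) = θ (Fin.last n) := rfl

theorem suspN_delta2_apply (θ : S.Red.carrier) :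
    (S.suspN n).δ₂ θ = (lpow S.v n (S.δ₂ θ), 0) := rfl

theorem mem_suspN_grading {j : ℤ} {c : S.Irr.carrier} {θ : Fin n → S.Red.carrier} :
    ((c, θ) : S.Irr.carrier × (Fin n → S.Red.carrier)) ∈ (S.suspN n).Irr.grading j ↔
      c ∈ S.Irr.grading (j - 2 * (n : ℤ)) ∧
        ∀ m : Fin n, θ m ∈ S.Red.grading (j - 2 * ((n - 1 - (m : ℕ) : ℕ) : ℤ) - 1) := by
  change (c, θ) ∈ (S.Irr.grading (j - 2 * (n : ℤ))).prod (Submodule.pi Set.univ fun m : Fin n =>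
    S.Red.grading (j - 2 * (((n - 1 - (m : ℕ) : ℕ)) : ℤ) - 1)) ↔ _
  simp [Submodule.mem_prod, Submodule.mem_pi]

end suspN

end SCData

section iotaN

variable (S : SCData R) (n : ℕ)

theorem iotaN_lam_apply (c : S.Irr.carrier) :
    (iotaN S n).lam c = ((c, 0) : S.Irr.carrier × (Fin n → S.Red.carrier)) := rfl

theorem iotaN_del2_apply (θ : S.Red.carrier) :
    (iotaN S (n + 1)).del2 θ =
      ((0, Pi.single 0 θ) : S.Irr.carrier × (Fin (n + 1) → S.Red.carrier)) := by
  refine Prod.ext rfl (funext fun m => ?_)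
  refine Fin.cases ?_ (fun m => ?_) m
  · exact (Pi.single_eq_same (M := fun _ : Fin (n + 1) => S.Red.carrier) 0 θ).symm
  · exact (Pi.single_eq_of_ne (M := fun _ : Fin (n + 1) => S.Red.carrier)
      (Fin.succ_ne_zero m) θ).symm

theorem lpow_suspN_v_iotaN_del2 {i : ℕ} (hi : i < n + 1) (θ : S.Red.carrier) :
    lpow (S.suspN (n + 1)).v i ((iotaN S (n + 1)).del2 θ) =
      ((0, Pi.single ⟨i, hi⟩ θ) : S.Irr.carrier × (Fin (n + 1) → S.Red.carrier)) := by
  induction i with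
  | zero => exact iotaN_del2_apply S n θ
  | succ i ih =>
    change (S.suspN (n + 1)).v (lpow _ i _) = _
    rw [ih (by omega), SCData.suspN_v_apply]
    refine Prod.ext (map_zero _) (funext fun m => ?_)
    refine Fin.cases ?_ (fun m => ?_) m
    · simp [Pi.single_apply, Fin.ext_iff]
    · simp [Pi.single_apply, Fin.ext_iff]

theorem iotaN_isMor (hr : S.r = 0) : (iotaN S (n + 1)).IsMor := by
  refine ⟨?_, ?_, ?_, ?_, ?_⟩
  · refine LinearMap.ext fun c => sub_eq_zero.2 ?_
    change (S.suspN (n + 1)).d ((iotaN S (n + 1)).lam c) = (iotaN S (n + 1)).lam (S.d c)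
    rw [iotaN_lam_apply, iotaN_lam_apply, SCData.suspN_d_apply]
    exact Prod.ext (by simp) rfl
  · refine LinearMap.ext fun c => ?_
    change (0 : S.Red.carrier) + 0 - 0 - 0 = 0
    simp
  · refine LinearMap.ext fun θ => ?_
    have h : (S.suspN (n + 1)).d ((iotaN S (n + 1)).del2 θ) =
        -(iotaN S (n + 1)).lam (S.δ₂ θ) := by
      rw [iotaN_lam_apply, iotaN_del2_apply, SCData.suspN_d_apply]
      refine Prod.ext ?_ (neg_zero (G := Fin (n + 1) → S.Red.carrier)).symm
      change _ = -S.δ₂ θ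
      simp [Fin.sum_univ_succ, lpow]
    change (S.suspN (n + 1)).d ((iotaN S (n + 1)).del2 θ) - (S.suspN (n + 1)).δ₂ 0
      + (iotaN S (n + 1)).lam (S.δ₂ θ) + (iotaN S (n + 1)).del2 (S.r θ) = 0
    rw [h, hr, LinearMap.zero_apply, map_zero, map_zero]
    abel
  · refine LinearMap.ext fun c => ?_
    have h : (S.suspN (n + 1)).v ((iotaN S (n + 1)).lam c) =
        (iotaN S (n + 1)).lam (S.v c) + (iotaN S (n + 1)).del2 (S.δ₁ c) := by
      rw [iotaN_lam_apply, iotaN_lam_apply, iotaN_del2_apply, SCData.suspN_v_apply]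
      refine Prod.ext (add_zero (S.v c)).symm (funext fun m => ?_)
      refine Fin.cases ?_ (fun m => ?_) m
      · exact (zero_add (S.δ₁ c)).symm.trans (congrArg _ (Pi.single_eq_same
          (M := fun _ : Fin (n + 1) => S.Red.carrier) 0 _).symm)
      · exact (zero_add (0 : S.Red.carrier)).symm.trans (congrArg _ (Pi.single_eq_of_ne
          (M := fun _ : Fin (n + 1) => S.Red.carrier) (Fin.succ_ne_zero m) (S.δ₁ c)).symm)
    change (0 : (S.suspN (n + 1)).Irr.carrier) + (S.suspN (n + 1)).d 0 +
      (iotaN S (n + 1)).lam (S.v c) - (S.suspN (n + 1)).v ((iotaN S (n + 1)).lam c) +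
      (iotaN S (n + 1)).del2 (S.δ₁ c) - (S.suspN (n + 1)).δ₂ 0 = 0
    rw [h, map_zero, map_zero]
    abel
  · refine LinearMap.ext fun θ => ?_
    change (0 : S.Red.carrier) - 0 = 0
    simp

theorem iotaN_degreesAt : (iotaN S (n + 1)).DegreesAt (2 * ((n + 1 : ℕ) : ℤ)) := by
  refine ⟨?_, .zero _, .zero _, ?_, .zero _⟩
  · refine GradedMod.isDeg_iff.2 fun i x hx => ?_
    exact (SCData.mem_suspN_grading S (n + 1)).2 ⟨by simpa using hx, fun m => Submodule.zero_mem _⟩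
  · refine GradedMod.isDeg_iff.2 fun i x hx => ?_
    rw [iotaN_del2_apply]
    refine (SCData.mem_suspN_grading S (n + 1)).2 ⟨Submodule.zero_mem _, fun m => ?_⟩
    refine Fin.cases ?_ (fun m => ?_) m
    · rw [Pi.single_eq_same]
      convert hx using 2
      push_cast
      simp
      ring
    · simp

theorem tauSMap_iotaN_succ {i : ℕ} (hi : i < n + 1) (θ : S.Red.carrier) :
    tauSMap (iotaN S (n + 1)) (i + 1) θ = if i = n then θ else 0 := by
  have h : tauSMap (iotaN S (n + 1)) (i + 1) θ =
      (S.suspN (n + 1)).δ₁ (lpow (S.suspN (n + 1)).v i ((iotaN S (n + 1)).del2 θ)) := by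
    have h₁ : (iotaN S (n + 1)).del1 = 0 := rfl
    have h₂ : (iotaN S (n + 1)).mu = 0 := rfl
    simp [tauSMap, h₁, h₂]
  rw [h, lpow_suspN_v_iotaN_del2 S n hi, SCData.suspN_delta1_apply]
  refine (Pi.single_apply (M := S.Red.carrier) (⟨i, hi⟩ : Fin (n + 1)) θ (Fin.last n)).trans ?_
  simp only [Fin.ext_iff, Fin.val_last, eq_comm]

theorem iotaN_strongHeight : (iotaN S (n + 1)).StrongHeight (n + 1) := by
  refine ⟨fun j hj => ?_, ?_⟩
  · cases j with
    | zero => rfl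
    | succ i =>
      refine LinearMap.ext fun θ => ?_
      rw [tauSMap_iotaN_succ S n (by omega), if_neg (by omega)]
      rfl
  · have h : ⇑(tauSMap (iotaN S (n + 1)) (n + 1)) = id :=
      funext fun θ => by rw [tauSMap_iotaN_succ S n (by omega), if_pos rfl]; rfl
    rw [h]
    exact Function.bijective_id

end iotaN

namespace SMap

variable {S T : SCData R}

theorem ext_components {f g : SMap S T} (hlam : f.lam = g.lam) (hmu : f.mu = g.mu)
    (hdel1 : f.del1 = g.del1) (hdel2 : f.del2 = g.del2) (hrho : f.rho = g.rho) : f = g := by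
  cases f
  cases g
  congr

/-- The maps `v'^mΔ₂ + Σ_{j<m} v'^j μ v^{m−1−j} δ₂`, defined recursively; they are the
components on the reducible summands of the factorization of `f` through `Σ^n C~`. -/
def factorCoeff (f : SMap S T) : ℕ → (S.Red.carrier →ₗ[R] T.Irr.carrier)
  | 0 => f.del2
  | m + 1 => f.mu ∘ₗ lpow S.v m ∘ₗ S.δ₂ + T.v ∘ₗ f.factorCoeff m

theorem factorCoeff_eq_sum (f : SMap S T) (m : ℕ) :
    f.factorCoeff m = lpow T.v m ∘ₗ f.del2 +
      ∑ j ∈ Finset.range m, lpow T.v j ∘ₗ f.mu ∘ₗ lpow S.v (m - 1 - j) ∘ₗ S.δ₂ := by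
  induction m with
  | zero => simp [factorCoeff, lpow]
  | succ m ih =>
    rw [factorCoeff, ih, Finset.sum_range_succ']
    ext θ
    have h : ∀ j, m + 1 - 1 - (j + 1) = m - 1 - j := by omega
    have h₀ : m + 1 - 1 - 0 = m := rfl
    simp only [LinearMap.add_apply, LinearMap.comp_apply, LinearMap.sum_apply, map_add, map_sum,
      lpow_succ_apply, lpow_zero_apply, h, h₀]
    abel

theorem tauSMap_succ (f : SMap S T) (m : ℕ) :
    tauSMap f (m + 1) = T.δ₁ ∘ₗ f.factorCoeff m + f.del1 ∘ₗ lpow S.v m ∘ₗ S.δ₂ := by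
  rw [tauSMap, factorCoeff_eq_sum]
  ext θ
  simp [LinearMap.sum_apply]
  abel

theorem isDeg_factorCoeff {f : SMap S T} {k : ℤ} (hS : S.Degrees) (hT : T.Degrees)
    (hf : f.DegreesAt k) (m : ℕ) : S.Red.IsDeg T.Irr (k - 1 - 2 * m) (f.factorCoeff m) := by
  induction m with
  | zero => simpa [factorCoeff] using hf.2.2.2.1
  | succ m ih =>
    exact (hf.2.1.comp (S.isDeg_lpow_v_delta2 hS m) (by push_cast; ring)).add
      (hT.2.1.comp ih (by push_cast; ring))

theorem isDeg_tauSMap {f : SMap S T} {k : ℤ} (hS : S.Degrees) (hT : T.Degrees)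
    (hf : f.DegreesAt k) (m : ℕ) : S.Red.IsDeg T.Red (k - 2 * m) (tauSMap f m) := by
  cases m with
  | zero => simpa [tauSMap] using hf.2.2.2.2
  | succ m =>
    rw [tauSMap_succ]
    exact (hT.2.2.1.comp (isDeg_factorCoeff hS hT hf m) (by push_cast; ring)).add
      (hf.2.2.1.comp (S.isDeg_lpow_v_delta2 hS m) (by push_cast; ring))

theorem d_factorCoeff {f : SMap S T} (hS : S.Relations) (hSr : S.RPerfect) (hT : T.Relations)
    (hf : f.IsMor) {m : ℕ} (hm : f.HasHeight m) (θ : S.Red.carrier) :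
    T.d (f.factorCoeff m θ) = T.δ₂ (tauSMap f m θ) - f.lam (lpow S.v m (S.δ₂ θ)) := by
  induction m with
  | zero =>
    have h := LinearMap.congr_fun hf.2.2.1 θ
    simp only [hSr.2.1, LinearMap.comp_zero, add_zero, LinearMap.add_apply, LinearMap.sub_apply,
      LinearMap.comp_apply, LinearMap.zero_apply] at h
    simp only [factorCoeff, tauSMap, lpow, LinearMap.id_apply]
    rw [← sub_eq_zero, ← h]
    abel
  | succ m ih =>
    have hμ := LinearMap.congr_fun hf.2.2.2.1 (lpow S.v m (S.δ₂ θ))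
    have hv := LinearMap.congr_fun hT.2.2.2.1 (f.factorCoeff m θ)
    have hδ := LinearMap.congr_fun (hSr.2.2 m) θ
    have ih := ih fun j hj => hm j (hj.trans m.lt_succ_self)
    simp only [LinearMap.add_apply, LinearMap.sub_apply, LinearMap.comp_apply,
      LinearMap.zero_apply] at hμ hv hδ
    rw [SCData.d_lpow_v_delta2 hS hSr, hδ] at hμ
    rw [ih, hm m m.lt_succ_self] at hv
    rw [tauSMap_succ]
    simp only [factorCoeff, lpow, LinearMap.add_apply, LinearMap.comp_apply, map_add, map_sub,
      map_zero, LinearMap.zero_apply] at hμ hv ⊢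
    rw [← sub_eq_zero]
    refine Eq.trans ?_ ((congrArg₂ (· + ·) hμ hv).trans (add_zero 0))
    abel

/-- The factorization of `f` through `ι~_n`. -/
def factorMap (f : SMap S T) (n : ℕ) : SMap (S.suspN n) T where
  lam := f.lam ∘ₗ LinearMap.fst R S.Irr.carrier (Fin n → S.Red.carrier) +
    ∑ m : Fin n, f.factorCoeff m ∘ₗ LinearMap.proj m ∘ₗ
      LinearMap.snd R S.Irr.carrier (Fin n → S.Red.carrier)
  mu := f.mu ∘ₗ LinearMap.fst R S.Irr.carrier (Fin n → S.Red.carrier)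
  del1 := f.del1 ∘ₗ LinearMap.fst R S.Irr.carrier (Fin n → S.Red.carrier)
  del2 := f.factorCoeff n
  rho := tauSMap (S := S) f n

theorem factorMap_lam_apply (f : SMap S T) (n : ℕ) (c : S.Irr.carrier)
    (θ : Fin n → S.Red.carrier) :
    (f.factorMap n).lam (c, θ) = f.lam c + ∑ m : Fin n, f.factorCoeff m (θ m) := by
  change f.lam c + (∑ m : Fin n, f.factorCoeff m ∘ₗ LinearMap.proj m ∘ₗ
      LinearMap.snd R S.Irr.carrier (Fin n → S.Red.carrier)) (c, θ) = _
  simp [LinearMap.sum_apply]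

theorem factorMap_comp_iotaN {f : SMap S T} {n : ℕ} (hf : f.HasHeight (n + 1)) :
    (f.factorMap (n + 1)).comp (iotaN S (n + 1)) = f := by
  have hρ : f.rho = 0 := hf 0 n.succ_pos
  have hlam : (f.factorMap (n + 1)).lam ∘ₗ (iotaN S (n + 1)).lam = f.lam := by
    refine LinearMap.ext fun c => ?_
    rw [LinearMap.comp_apply, iotaN_lam_apply, factorMap_lam_apply]
    simp
  have hdel2 : (f.factorMap (n + 1)).lam ∘ₗ (iotaN S (n + 1)).del2 = f.del2 := by
    refine LinearMap.ext fun θ => ?_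
    rw [LinearMap.comp_apply, iotaN_del2_apply, factorMap_lam_apply, Fin.sum_univ_succ]
    simp [factorCoeff]
  refine ext_components hlam ?_ ?_ ?_ ?_
  · refine LinearMap.ext fun c => ?_
    change (f.factorMap (n + 1)).lam 0 + f.mu c + f.factorCoeff (n + 1) 0 = f.mu c
    simp
  · refine LinearMap.ext fun c => ?_
    change f.del1 c + tauSMap f (n + 1) 0 = f.del1 c
    simp
  · refine LinearMap.ext fun θ => ?_
    change ((f.factorMap (n + 1)).lam ∘ₗ (iotaN S (n + 1)).del2) θ + f.factorCoeff (n + 1) 0 = _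
    simp [hdel2]
  · rw [hρ]
    exact LinearMap.comp_zero _

theorem factorMap_degreesAt {f : SMap S T} {k : ℤ} (hS : S.Degrees) (hT : T.Degrees)
    (hf : f.DegreesAt k) (n : ℕ) : (f.factorMap n).DegreesAt (k - 2 * n) := by
  refine ⟨?_, ?_, ?_, ?_, isDeg_tauSMap hS hT hf n⟩
  · refine GradedMod.isDeg_iff.2 ?_
    rintro i ⟨c, θ⟩ hx
    replace hx := (SCData.mem_suspN_grading S n).1 hx
    rw [factorMap_lam_apply]
    refine Submodule.add_mem _ (hf.1.mem (by ring) hx.1) (Submodule.sum_mem _ fun m _ => ?_)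
    exact (isDeg_factorCoeff hS hT hf m).mem (by omega) (hx.2 m)
  · refine GradedMod.isDeg_iff.2 ?_
    rintro i ⟨c, θ⟩ hx
    exact hf.2.1.mem (by ring) ((SCData.mem_suspN_grading S n).1 hx).1
  · refine GradedMod.isDeg_iff.2 ?_
    rintro i ⟨c, θ⟩ hx
    exact hf.2.2.1.mem (by ring) ((SCData.mem_suspN_grading S n).1 hx).1
  · have h := isDeg_factorCoeff hS hT hf n
    rwa [sub_right_comm] at h

theorem factorMap_isMor {f : SMap S T} (hS : S.Relations) (hSr : S.RPerfect)
    (hT : T.Relations) (hTr : T.RPerfect) (hf : f.IsMor) {n : ℕ} (hn : f.HasHeight (n + 1)) :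
    (f.factorMap (n + 1)).IsMor := by
  have hρ : f.rho = 0 := hn 0 n.succ_pos
  have hd : ∀ m ≤ n + 1, ∀ θ, T.d (f.factorCoeff m θ) =
      T.δ₂ (tauSMap f m θ) - f.lam (lpow S.v m (S.δ₂ θ)) := fun m hm =>
    d_factorCoeff hS hSr hT hf fun j hj => hn j (hj.trans_le hm)
  refine ⟨?_, ?_, ?_, ?_, ?_⟩
  · refine LinearMap.ext ?_
    rintro ⟨c, θ⟩
    change T.d ((f.factorMap (n + 1)).lam (c, θ)) -
      (f.factorMap (n + 1)).lam ((S.suspN (n + 1)).d (c, θ)) = 0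
    rw [SCData.suspN_d_apply, factorMap_lam_apply, factorMap_lam_apply]
    have h := LinearMap.congr_fun hf.1 c
    simp only [LinearMap.sub_apply, LinearMap.comp_apply, LinearMap.zero_apply] at h
    have h' : ∀ m : Fin (n + 1), T.d (f.factorCoeff m (θ m)) =
        -f.lam (lpow S.v m (S.δ₂ (θ m))) := fun m => by
      rw [hd m m.2.le, hn m m.2]; simp
    simp [map_sum, h', sub_eq_zero.1 h]
  · refine LinearMap.ext ?_
    rintro ⟨c, θ⟩
    change f.del1 ((S.suspN (n + 1)).d (c, θ)).1 +
      tauSMap f (n + 1) ((S.suspN (n + 1)).δ₁ (c, θ)) -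
      T.δ₁ ((f.factorMap (n + 1)).lam (c, θ)) - T.r (f.del1 c) = 0
    rw [SCData.suspN_d_apply, factorMap_lam_apply, SCData.suspN_delta1_apply, hTr.2.1]
    have h := LinearMap.congr_fun hf.2.1 c
    simp only [hρ, hTr.2.1, LinearMap.sub_apply, LinearMap.add_apply, LinearMap.comp_apply,
      LinearMap.zero_apply, add_zero, sub_zero] at h
    have h' : ∀ m : Fin n, T.δ₁ (f.factorCoeff m (θ m.castSucc)) =
        -f.del1 (lpow S.v m (S.δ₂ (θ m.castSucc))) := fun m => by
      have := LinearMap.congr_fun (hn (m + 1) (by omega)) (θ m.castSucc)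
      rw [tauSMap_succ] at this
      exact eq_neg_of_add_eq_zero_left this
    simp only [tauSMap_succ, map_sum, map_add, map_sub, Fin.sum_univ_castSucc, LinearMap.add_apply,
      LinearMap.comp_apply, Fin.val_castSucc, Fin.val_last, h', sub_eq_zero.1 h,
      Finset.sum_neg_distrib, LinearMap.zero_apply]
    abel
  · refine LinearMap.ext fun (θ : S.Red.carrier) => ?_
    change T.d (f.factorCoeff (n + 1) θ) - T.δ₂ (tauSMap f (n + 1) θ) +
      (f.factorMap (n + 1)).lam ((S.suspN (n + 1)).δ₂ θ) + f.factorCoeff (n + 1) 0 = 0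
    rw [SCData.suspN_delta2_apply, factorMap_lam_apply, hd _ le_rfl]
    simp
  · refine LinearMap.ext ?_
    rintro ⟨c, θ⟩
    change f.mu ((S.suspN (n + 1)).d (c, θ)).1 + T.d (f.mu c) +
      (f.factorMap (n + 1)).lam ((S.suspN (n + 1)).v (c, θ)) -
      T.v ((f.factorMap (n + 1)).lam (c, θ)) +
      f.factorCoeff (n + 1) ((S.suspN (n + 1)).δ₁ (c, θ)) - T.δ₂ (f.del1 c) = 0
    rw [SCData.suspN_d_apply, SCData.suspN_v_apply, factorMap_lam_apply, factorMap_lam_apply,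
      SCData.suspN_delta1_apply]
    have hcons : ∑ m : Fin (n + 1), f.factorCoeff m
        (Fin.cons (α := fun _ => S.Red.carrier) (S.δ₁ c) (fun m : Fin n => θ m.castSucc) m) =
        f.del2 (S.δ₁ c) + ∑ m : Fin n, f.factorCoeff (m + 1) (θ m.castSucc) := by
      rw [Fin.sum_univ_succ]
      rfl
    have h := LinearMap.congr_fun hf.2.2.2.1 c
    simp only [LinearMap.sub_apply, LinearMap.add_apply, LinearMap.comp_apply,
      LinearMap.zero_apply] at h
    simp only [hcons, factorCoeff,
      LinearMap.add_apply, LinearMap.comp_apply, map_add, map_sub, map_sum,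
      Finset.sum_add_distrib, Fin.sum_univ_castSucc, Fin.val_castSucc, Fin.val_last]
    rw [← h]
    abel
  · refine LinearMap.ext fun θ => ?_
    change tauSMap f (n + 1) 0 - T.r (tauSMap f (n + 1) θ) = 0
    simp [hTr.2.1]

end SMap

/-- For an even-degree morphism `λ~` of height `n ≥ 1` between `r`-perfect
`S`-complexes: (a) `ι~_n : C~ → Σ^n C~` is a strong height `n` morphism; (b) there is a
height `0` morphism `λ~' : Σ^n C~ → C~'` with `ρ`-component `τ_n(λ~)` such that
`λ~' ∘ ι~_n = λ~`, which is strong height `0` whenever `λ~` is strong height `n`. -/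
theorem height_factors_through_suspN {R : Type u} [CommRing R] {S T : SCData R}
    (hS : S.IsSComplex) (hSr : S.RPerfect) (hT : T.IsSComplex) (hTr : T.RPerfect)
    (f : SMap S T) (hf : f.IsMor) (k : ℤ) (hk : Even k) (hfdeg : f.DegreesAt k)
    (n : ℕ) (hn : 1 ≤ n) (hht : f.HasHeight n) :
    ((iotaN S n).IsMor ∧ (iotaN S n).DegreesAt (2 * (n : ℤ)) ∧ (iotaN S n).StrongHeight n) ∧
    (∃ g : SMap (S.suspN n) T, g.IsMor ∧ g.DegreesAt (k - 2 * (n : ℤ)) ∧ g.HasHeight 0 ∧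
      g.rho = tauSMap f n ∧ g.comp (iotaN S n) = f ∧
      (f.StrongHeight n → g.StrongHeight 0)) := by
  obtain ⟨p, rfl⟩ : ∃ p, n = p + 1 := ⟨n - 1, by omega⟩
  obtain ⟨-, -, hSdeg, hSrel⟩ := hS
  obtain ⟨-, -, hTdeg, hTrel⟩ := hT
  exact ⟨⟨iotaN_isMor S p hSr.2.1, iotaN_degreesAt S p, iotaN_strongHeight S p⟩, f.factorMap (p + 1),
    SMap.factorMap_isMor hSrel hSr hTrel hTr hf hht,
    SMap.factorMap_degreesAt hSdeg hTdeg hfdeg (p + 1), fun _ hj => absurd hj (Nat.not_lt_zero _),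
    rfl, SMap.factorMap_comp_iotaN hht,
    fun h => ⟨fun _ hj => absurd hj (Nat.not_lt_zero _), h.2⟩⟩
end

section
/- Let C~, C~′, C~″ be r-perfect S-complexes over a commutative ring R, and let λ~: C~ → C~′ and λ~′: C~′ → C~″ be even-degree morphisms with associated sequences {τ_i} and {τ′_i}. Let {τ°_i} be the sequence associated to the composite morphism λ~′λ~. Then τ°_m = Σ_{k=0}^{m} τ′_{m−k} τ_k for all m ≥ 0. Consequently, if λ~ is a (strong) height n morphism and λ~′ is a (strong) height m morphism, then λ~′λ~ is a (strong) height n + m morphism. -/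
set_option maxHeartbeats 1000000

open Function

universe u

variable {R : Type u} [CommRing R]

theorem lpow_apply_map {R : Type u} [CommRing R] {M : Type u} [AddCommGroup M] [Module R M]
    (f : M →ₗ[R] M) (n : ℕ) (x : M) : lpow f n (f x) = lpow f (n + 1) x := by
  induction n with
  | zero => rfl
  | succ n ih => exact congrArg f ih

namespace SCData

variable {R : Type u} [CommRing R] (S : SCData R)

/-- The largest `v`-stable submodule of `C` on which `δ₁` vanishes. -/
def stableKer : Submodule R S.Irr.carrier :=
  ⨅ j : ℕ, LinearMap.ker (S.δ₁ ∘ₗ lpow S.v j)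

variable {S}

theorem mem_stableKer {x : S.Irr.carrier} :
    x ∈ S.stableKer ↔ ∀ j : ℕ, S.δ₁ (lpow S.v j x) = 0 := by
  simp [stableKer]

theorem v_mem_stableKer {x : S.Irr.carrier} (hx : x ∈ S.stableKer) : S.v x ∈ S.stableKer := by
  rw [mem_stableKer] at hx ⊢
  intro j
  rw [lpow_apply_map]
  exact hx (j + 1)

theorem δ₁_eq_zero_of_mem_stableKer {x : S.Irr.carrier} (hx : x ∈ S.stableKer) : S.δ₁ x = 0 :=
  mem_stableKer.1 hx 0

theorem RPerfect.δ₁_lpow_δ₂ (hr : S.RPerfect) (i : ℕ) (x : S.Red.carrier) :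
    S.δ₁ (lpow S.v i (S.δ₂ x)) = 0 :=
  LinearMap.congr_fun (hr.2.2 i) x

theorem δ₂_mem_stableKer (hr : S.RPerfect) (x : S.Red.carrier) : S.δ₂ x ∈ S.stableKer :=
  mem_stableKer.2 fun j => hr.δ₁_lpow_δ₂ j x

theorem Relations.d_v (h : S.Relations) (x : S.Irr.carrier) :
    S.d (S.v x) = S.v (S.d x) + S.δ₂ (S.δ₁ x) := by
  have := LinearMap.congr_fun h.2.2.2.1 x
  simp only [LinearMap.sub_apply, LinearMap.comp_apply, LinearMap.zero_apply] at this
  rw [← sub_eq_zero, ← this]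
  abel

theorem Relations.δ₁_d (h : S.Relations) (hr : S.RPerfect) (x : S.Irr.carrier) :
    S.δ₁ (S.d x) = 0 := by
  simpa [hr.2.1] using LinearMap.congr_fun h.2.1 x

theorem Relations.d_δ₂ (h : S.Relations) (hr : S.RPerfect) (x : S.Red.carrier) :
    S.d (S.δ₂ x) = 0 := by
  simpa [hr.2.1] using LinearMap.congr_fun h.2.2.1 x

theorem d_mem_stableKer (h : S.Relations) (hr : S.RPerfect) (x : S.Irr.carrier) :
    S.d x ∈ S.stableKer := by
  rw [mem_stableKer]
  intro j
  induction j generalizing x with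
  | zero => exact h.δ₁_d hr x
  | succ j ih =>
    rw [← lpow_apply_map, eq_sub_of_add_eq (h.d_v x).symm, map_sub, map_sub, ih,
      hr.δ₁_lpow_δ₂, sub_zero]

theorem Relations.d_lpow_δ₂ (h : S.Relations) (hr : S.RPerfect) (i : ℕ) (x : S.Red.carrier) :
    S.d (lpow S.v i (S.δ₂ x)) = 0 := by
  induction i with
  | zero => exact h.d_δ₂ hr x
  | succ i ih =>
    change S.d (S.v (lpow S.v i (S.δ₂ x))) = 0
    rw [h.d_v, ih, hr.δ₁_lpow_δ₂, map_zero, map_zero, add_zero]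

end SCData

namespace SMap

variable {R : Type u} [CommRing R] {S T U : SCData R}

/-- The maps `e_i = v'^i Δ₂ + Σ_{j<i} v'^j μ v^{i−1−j} δ₂`, in recursive form, so that
`τ_{i+1} = Δ₁ v^i δ₂ + δ₁' e_i`. -/
def tauAux (f : SMap S T) : ℕ → (S.Red.carrier →ₗ[R] T.Irr.carrier)
  | 0 => f.del2
  | i + 1 => T.v ∘ₗ tauAux f i + f.mu ∘ₗ lpow S.v i ∘ₗ S.δ₂

theorem tauAux_eq_sum (f : SMap S T) (i : ℕ) :
    f.tauAux i = lpow T.v i ∘ₗ f.del2 +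
      ∑ j ∈ Finset.range i, lpow T.v j ∘ₗ f.mu ∘ₗ lpow S.v (i - 1 - j) ∘ₗ S.δ₂ := by
  induction i with
  | zero => simp [tauAux, lpow]
  | succ i ih =>
    ext x
    simp only [tauAux, ih, Finset.sum_range_succ', LinearMap.add_apply, LinearMap.comp_apply,
      LinearMap.sum_apply, map_add, map_sum, ← add_assoc]
    congr 2
    refine Finset.sum_congr rfl fun j _ => ?_
    rw [show i + 1 - 1 - (j + 1) = i - 1 - j by omega]
    rfl

theorem tauSMap_succ_apply (f : SMap S T) (i : ℕ) (x : S.Red.carrier) :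
    tauSMap f (i + 1) x = f.del1 (lpow S.v i (S.δ₂ x)) + T.δ₁ (f.tauAux i x) := by
  simp only [tauSMap, tauAux_eq_sum, LinearMap.add_apply, LinearMap.comp_apply,
    LinearMap.sum_apply, map_add, map_sum]
  abel

theorem IsMor.δ₁_lam {f : SMap S T} (hf : f.IsMor) (hTr : T.RPerfect) (x : S.Irr.carrier) :
    T.δ₁ (f.lam x) = f.del1 (S.d x) + f.rho (S.δ₁ x) := by
  have := LinearMap.congr_fun hf.2.1 x
  simp only [hTr.2.1, LinearMap.sub_apply, LinearMap.add_apply, LinearMap.comp_apply,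
    LinearMap.zero_apply, sub_zero] at this
  exact (sub_eq_zero.1 this).symm

theorem IsMor.lam_δ₂ {f : SMap S T} (hf : f.IsMor) (hSr : S.RPerfect) (x : S.Red.carrier) :
    f.lam (S.δ₂ x) = T.δ₂ (f.rho x) - T.d (f.del2 x) := by
  have := LinearMap.congr_fun hf.2.2.1 x
  simp only [hSr.2.1, LinearMap.sub_apply, LinearMap.add_apply, LinearMap.comp_apply,
    LinearMap.zero_apply, map_zero, add_zero] at this
  rw [← sub_eq_zero, ← this]
  abel

theorem IsMor.v_lam {f : SMap S T} (hf : f.IsMor) (x : S.Irr.carrier) :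
    T.v (f.lam x) = f.mu (S.d x) + T.d (f.mu x) + f.lam (S.v x) + f.del2 (S.δ₁ x) -
      T.δ₂ (f.del1 x) := by
  have := LinearMap.congr_fun hf.2.2.2.1 x
  simp only [LinearMap.sub_apply, LinearMap.add_apply, LinearMap.comp_apply,
    LinearMap.zero_apply] at this
  rw [eq_comm, ← sub_eq_zero, ← this]
  abel

/-- `λ v^i δ₂` agrees with `Σ_{k≤i} v'^{i−k} δ₂' τ_k` up to the boundary `d' e_i`. -/
theorem IsMor.lam_lpow_δ₂ {f : SMap S T} (hf : f.IsMor) (hS : S.Relations) (hSr : S.RPerfect)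
    (hT : T.Relations) (i : ℕ) (x : S.Red.carrier) :
    f.lam (lpow S.v i (S.δ₂ x)) =
      ∑ k ∈ Finset.range (i + 1), lpow T.v (i - k) (T.δ₂ (tauSMap f k x)) -
        T.d (f.tauAux i x) := by
  induction i with
  | zero => simpa [tauSMap, tauAux, lpow] using hf.lam_δ₂ hSr x
  | succ i ih =>
    have hsum : ∑ k ∈ Finset.range (i + 1), lpow T.v (i + 1 - k) (T.δ₂ (tauSMap f k x)) =
        T.v (∑ k ∈ Finset.range (i + 1), lpow T.v (i - k) (T.δ₂ (tauSMap f k x))) := by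
      rw [map_sum]
      refine Finset.sum_congr rfl fun k hk => ?_
      rw [Nat.succ_sub (Finset.mem_range_succ_iff.1 hk)]
      rfl
    have hv := hf.v_lam (lpow S.v i (S.δ₂ x))
    rw [hS.d_lpow_δ₂ hSr, hSr.δ₁_lpow_δ₂, ih, map_sub] at hv
    rw [Finset.sum_range_succ, hsum, Nat.sub_self, tauSMap_succ_apply]
    simp only [tauAux, lpow, LinearMap.add_apply, LinearMap.comp_apply, LinearMap.id_apply,
      map_add, hT.d_v, map_zero] at hv ⊢
    rw [sub_eq_iff_eq_add] at hv
    rw [hv]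
    abel

/-- The sequence `e°` of a composite agrees with `λ' e_i + Σ_{k≤i} e'_{i−k} τ_k` up to an
element of the `v`-stable kernel of `δ₁`. -/
theorem tauAux_comp_sub_mem_stableKer {f : SMap S T} {g : SMap T U} (hf : f.IsMor) (hg : g.IsMor)
    (hS : S.Relations) (hSr : S.RPerfect) (hT : T.Relations) (hU : U.Relations)
    (hUr : U.RPerfect) (i : ℕ) (x : S.Red.carrier) :
    (g.comp f).tauAux i x - g.lam (f.tauAux i x) -
      ∑ k ∈ Finset.range (i + 1), g.tauAux (i - k) (tauSMap f k x) ∈ U.stableKer := by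
  induction i with
  | zero => simp [tauAux, tauSMap, comp]
  | succ i ih =>
    have hsum : ∑ k ∈ Finset.range (i + 1), g.tauAux (i + 1 - k) (tauSMap f k x) =
        U.v (∑ k ∈ Finset.range (i + 1), g.tauAux (i - k) (tauSMap f k x)) +
        g.mu (∑ k ∈ Finset.range (i + 1), lpow T.v (i - k) (T.δ₂ (tauSMap f k x))) := by
      rw [map_sum, map_sum, ← Finset.sum_add_distrib]
      refine Finset.sum_congr rfl fun k hk => ?_
      rw [Nat.succ_sub (Finset.mem_range_succ_iff.1 hk)]
      rfl
    have hmem := U.stableKer.sub_mem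
      (U.stableKer.add_mem (SCData.v_mem_stableKer ih)
        (SCData.d_mem_stableKer hU hUr (g.mu (f.tauAux i x))))
      (SCData.δ₂_mem_stableKer hUr (g.del1 (f.tauAux i x)))
    convert hmem using 1
    rw [Finset.sum_range_succ, hsum, Nat.sub_self, tauSMap_succ_apply,
      sub_eq_iff_eq_add.1 (hf.lam_lpow_δ₂ hS hSr hT i x).symm]
    simp only [tauAux, comp, LinearMap.add_apply, LinearMap.comp_apply, map_add, map_sub,
      hg.v_lam]
    abel

theorem tauSMap_comp {f : SMap S T} {g : SMap T U} (hf : f.IsMor) (hg : g.IsMor)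
    (hS : S.Relations) (hSr : S.RPerfect) (hT : T.Relations) (hU : U.Relations)
    (hUr : U.RPerfect) (m : ℕ) :
    tauSMap (g.comp f) m =
      ∑ k ∈ Finset.range (m + 1), tauSMap g (m - k) ∘ₗ tauSMap f k := by
  ext x
  cases m with
  | zero => simp [tauSMap, comp]
  | succ i =>
    have hδ := SCData.δ₁_eq_zero_of_mem_stableKer
      (tauAux_comp_sub_mem_stableKer hf hg hS hSr hT hU hUr i x)
    have hlam := hf.lam_lpow_δ₂ hS hSr hT i x
    have hsum : ∑ k ∈ Finset.range (i + 1), tauSMap g (i + 1 - k) (tauSMap f k x) =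
        g.del1 (∑ k ∈ Finset.range (i + 1), lpow T.v (i - k) (T.δ₂ (tauSMap f k x))) +
        U.δ₁ (∑ k ∈ Finset.range (i + 1), g.tauAux (i - k) (tauSMap f k x)) := by
      rw [map_sum, map_sum, ← Finset.sum_add_distrib]
      refine Finset.sum_congr rfl fun k hk => ?_
      rw [Nat.succ_sub (Finset.mem_range_succ_iff.1 hk), tauSMap_succ_apply]
    simp only [LinearMap.sum_apply, LinearMap.comp_apply]
    rw [Finset.sum_range_succ, hsum, Nat.sub_self, tauSMap_succ_apply, tauSMap_succ_apply]
    rw [map_sub, map_sub, sub_sub, sub_eq_zero] at hδ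
    rw [hδ, hg.δ₁_lam hUr]
    simp only [comp, LinearMap.add_apply, LinearMap.comp_apply, hlam, map_sub, map_add, tauSMap]
    abel

end SMap

/-- For even-degree morphisms between `r`-perfect `S`-complexes, the
`τ`-sequence of a composite satisfies `τ°_m = Σ_{k=0}^m τ'_{m−k} τ_k`; consequently heights
(and strong heights) add under composition. -/
theorem tau_comp_and_height_additivity {R : Type u} [CommRing R] {S T U : SCData R}
    (hS : S.IsSComplex) (hSr : S.RPerfect) (hT : T.IsSComplex) (hTr : T.RPerfect)
    (hU : U.IsSComplex) (hUr : U.RPerfect)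
    (f : SMap S T) (g : SMap T U) (hf : f.IsMor) (hg : g.IsMor)
    (kf kg : ℤ) (hkf : Even kf) (hkg : Even kg)
    (hfd : f.DegreesAt kf) (hgd : g.DegreesAt kg) :
    (∀ m : ℕ, tauSMap (g.comp f) m =
      ∑ k ∈ Finset.range (m + 1), tauSMap g (m - k) ∘ₗ tauSMap f k) ∧
    (∀ n m : ℕ, f.HasHeight n → g.HasHeight m → (g.comp f).HasHeight (n + m)) ∧
    (∀ n m : ℕ, f.StrongHeight n → g.StrongHeight m → (g.comp f).StrongHeight (n + m)) := by
  have hcomp := SMap.tauSMap_comp hf hg hS.2.2.2 hSr hT.2.2.2 hU.2.2.2 hUr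
  have hheight : ∀ n m : ℕ, f.HasHeight n → g.HasHeight m → (g.comp f).HasHeight (n + m) := by
    intro n m hn hm j hj
    rw [hcomp]
    refine Finset.sum_eq_zero fun k hkj => ?_
    rw [Finset.mem_range] at hkj
    by_cases hk : k < n
    · rw [hn k hk, LinearMap.comp_zero]
    · rw [hm (j - k) (by omega), LinearMap.zero_comp]
  refine ⟨hcomp, hheight, fun n m hn hm => ⟨hheight n m hn.1 hm.1, ?_⟩⟩
  have htop : tauSMap (g.comp f) (n + m) = tauSMap g m ∘ₗ tauSMap f n := by
    rw [hcomp, Finset.sum_eq_single n]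
    · rw [Nat.add_sub_cancel_left]
    · intro k hkj hkn
      rw [Finset.mem_range] at hkj
      by_cases hk : k < n
      · rw [hn.1 k hk, LinearMap.comp_zero]
      · rw [hm.1 (n + m - k) (by omega), LinearMap.zero_comp]
    · intro h
      exact absurd (Finset.mem_range.2 (by omega)) h
  rw [htop, LinearMap.coe_comp]
  exact hm.2.comp hn.2
end
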